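/- The sequence \Delta_n := n (p_{n-1} q_n - p_n q_{n-1}), where q_n = \sum_{k=0}^n \binom{n}{k}^2 k! and p_n = \sum_{k=0}^n \binom{n}{k}^2 k!(2H_{n-k}-H_k), satisfies for all n \ge 3 the third-order recurrence (n-1)(n-2)\Delta_{n+2} = (n-2)(n+1)(n^2+3n-2)\Delta_{n+1} - n^2(2n^3+n^2-7n-4)\Delta_n + (n-1)^2 n^4 \Delta_{n-1}, with initial values \Delta_1 = -1, \Delta_2 = -2, \Delta_3 = -5, \Delta_4 = 8. -/

import Mathlib

open Finset

noncomputable def H (m : ℕ) : ℚ := ∑ j ∈ Finset.range m, (1 : ℚ) / (j + 1)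

noncomputable def q (n : ℕ) : ℚ :=
  ∑ k ∈ Finset.range (n + 1), ((n.choose k : ℚ))^2 * (Nat.factorial k : ℚ)

noncomputable def p (n : ℕ) : ℚ :=
  ∑ k ∈ Finset.range (n + 1),
    ((n.choose k : ℚ))^2 * (Nat.factorial k : ℚ) * (2 * H (n - k) - H k)

/-- `dd n = p_{n-1} q_n - p_n q_{n-1}`, with the conventions `p_{-1} = 1`, `q_{-1} = 0`,
so `dd 0 = 1`. -/
noncomputable def dd : ℕ → ℚ
  | 0 => 1
  | (n + 1) => p n * q (n + 1) - p (n + 1) * q n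

/-- `Δ n = n (p_{n-1} q_n - p_n q_{n-1})`. -/
noncomputable def Δ (n : ℕ) : ℚ := (n : ℚ) * dd n

theorem H_succ (m : ℕ) : H (m + 1) = H m + 1 / ((m : ℚ) + 1) := by
  simp [H, Finset.sum_range_succ]

/-- The summand of `q`. -/
noncomputable def qTerm (n k : ℕ) : ℚ := (n.choose k : ℚ) ^ 2 * (Nat.factorial k : ℚ)

/-- The summand of `p`. -/
noncomputable def pTerm (n k : ℕ) : ℚ := qTerm n k * (2 * H (n - k) - H k)

theorem q_eq_sum (n : ℕ) : q n = ∑ k ∈ Finset.range (n + 1), qTerm n k := rfl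

theorem p_eq_sum (n : ℕ) : p n = ∑ k ∈ Finset.range (n + 1), pTerm n k := rfl

theorem qTerm_add (k j : ℕ) :
    qTerm (k + j) k
      = (Nat.factorial (k + j) : ℚ) ^ 2 / ((Nat.factorial k : ℚ) * (Nat.factorial j : ℚ) ^ 2) := by
  have hk : (Nat.factorial k : ℚ) ≠ 0 := by positivity
  have hj : (Nat.factorial j : ℚ) ≠ 0 := by positivity
  rw [qTerm, Nat.cast_add_choose]
  field_simp

theorem pTerm_add (k j : ℕ) : pTerm (k + j) k = qTerm (k + j) k * (2 * H j - H k) := by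
  rw [pTerm, Nat.add_sub_cancel_left]

theorem qTerm_add_succ (k j : ℕ) :
    qTerm (k + j + 1) k = qTerm (k + j) k * ((k + j + 1 : ℚ) / (j + 1)) ^ 2 := by
  have hk : (Nat.factorial k : ℚ) ≠ 0 := by positivity
  have hj : (Nat.factorial j : ℚ) ≠ 0 := by positivity
  rw [add_assoc, qTerm_add, qTerm_add, ← add_assoc, Nat.factorial_succ, Nat.factorial_succ]
  push_cast
  field_simp

theorem qTerm_succ_add (k j : ℕ) :
    qTerm (k + j + 1) (k + 1) = qTerm (k + j + 1) k * ((j + 1 : ℚ) ^ 2 / (k + 1)) := by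
  have hk : (Nat.factorial k : ℚ) ≠ 0 := by positivity
  have hj : (Nat.factorial j : ℚ) ≠ 0 := by positivity
  have h : k + j + 1 = k + 1 + j := by ring
  rw [show qTerm (k + j + 1) k = _ from qTerm_add k (j + 1), h, qTerm_add, ← h, ← add_assoc,
    Nat.factorial_succ k, Nat.factorial_succ j]
  push_cast
  field_simp

theorem qTerm_zero_right (n : ℕ) : qTerm n 0 = 1 := by simp [qTerm]

/-- The rational certificate `R(n, k)` for `q`, at `n = k + j`. -/
noncomputable def cert (k j : ℚ) : ℚ :=
  (k + j + 1) ^ 2 * k * ((j + 2) * (j + 1) - (k + j + 2)) / ((j + 1) ^ 2 * (j + 2) ^ 2)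

/-- The derivative of the certificate `R(n, k)` in `k` for fixed `n`, at `n = k + j`. -/
noncomputable def certDeriv (k j : ℚ) : ℚ :=
  (k + j + 1) ^ 2 *
    (((j + 2) * (j + 1) - (k + j + 2)) - k * (2 * j + 3)
      + k * ((j + 2) * (j + 1) - (k + j + 2)) * (2 / (j + 1) + 2 / (j + 2)))
    / ((j + 1) ^ 2 * (j + 2) ^ 2)

theorem sum_range_qTerm_telescope (m j : ℕ) :
    ∑ k ∈ Finset.range m, (qTerm (m + j + 2) k - 2 * (m + j + 2) * qTerm (m + j + 1) k
        + (m + j + 1) ^ 2 * qTerm (m + j) k)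
      = qTerm (m + j) m * cert m j := by
  induction m generalizing j with
  | zero => simp [cert]
  | succ m ih =>
    have e : m + 1 + j = m + (j + 1) := by ring
    have ih' := ih (j + 1)
    rw [Finset.sum_range_succ, e]
    push_cast at ih' ⊢
    have c : (m + 1 + j : ℚ) = m + (j + 1) := by ring
    simp only [c]
    rw [ih']
    have h1 := qTerm_add_succ m (j + 1)
    have h2 := qTerm_add_succ m (j + 2)
    have h3 := qTerm_succ_add m j
    simp only [← add_assoc] at h1 h2 h3 ⊢
    push_cast at h1 h2 h3
    rw [h2, h1, h3, cert, cert]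
    field_simp
    ring

theorem sum_range_pTerm_telescope (m j : ℕ) :
    ∑ k ∈ Finset.range m, (pTerm (m + j + 2) k - 2 * (m + j + 2) * pTerm (m + j + 1) k
        + (m + j + 1) ^ 2 * pTerm (m + j) k)
      = qTerm (m + j) m * (cert m j * (2 * H j - H m) + certDeriv m j)
        - (m + j : ℚ) / (m + j + 2) := by
  induction m generalizing j with
  | zero =>
    simp only [cert, certDeriv, zero_add, qTerm_zero_right, Finset.range_zero, Finset.sum_empty]
    push_cast
    field_simp
    ring
  | succ m ih =>
    have e : m + 1 + j = m + (j + 1) := by ring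
    have ih' := ih (j + 1)
    rw [Finset.sum_range_succ, e]
    push_cast at ih' ⊢
    have c : (m + 1 + j : ℚ) = m + (j + 1) := by ring
    simp only [c]
    rw [ih']
    have h1 := qTerm_add_succ m (j + 1)
    have h2 := qTerm_add_succ m (j + 2)
    have h3 := qTerm_succ_add m j
    have g0 := pTerm_add m (j + 1)
    have g1 := pTerm_add m (j + 1 + 1)
    have g2 := pTerm_add m (j + 1 + 1 + 1)
    simp only [← add_assoc] at h1 h2 h3 g0 g1 g2 ⊢
    push_cast at h1 h2 h3
    rw [g2, g1, g0, h2, h1, h3, H_succ (j + 1 + 1), H_succ (j + 1), H_succ j, H_succ m,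
      cert, cert, certDeriv, certDeriv]
    push_cast
    field_simp
    ring

theorem qTerm_self (n : ℕ) : qTerm n n = (Nat.factorial n : ℚ) := by simp [qTerm]

theorem qTerm_succ_self (n : ℕ) :
    qTerm (n + 1) n = (n + 1 : ℚ) ^ 2 * (Nat.factorial n : ℚ) := by
  simp [qTerm]

theorem qTerm_add_two_self (n : ℕ) :
    qTerm (n + 2) n = ((n + 1 : ℚ) * (n + 2) / 2) ^ 2 * (Nat.factorial n : ℚ) := by
  have h1 := qTerm_add_succ n 1
  rw [qTerm_succ_self] at h1
  rw [h1]
  push_cast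
  ring

theorem q_recurrence (n : ℕ) :
    q (n + 2) - 2 * (n + 2) * q (n + 1) + (n + 1) ^ 2 * q n = 0 := by
  have h := sum_range_qTerm_telescope n 0
  simp only [Finset.sum_add_distrib, Finset.sum_sub_distrib, ← Finset.mul_sum, cert, add_zero,
    Nat.cast_zero, qTerm_self] at h
  rw [q_eq_sum, q_eq_sum, q_eq_sum]
  simp only [Finset.sum_range_succ _ n, Finset.sum_range_succ _ (n + 1),
    Finset.sum_range_succ _ (n + 2), qTerm_self, qTerm_succ_self, qTerm_add_two_self,
    Nat.factorial_succ]
  push_cast at h ⊢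
  linear_combination h

theorem p_recurrence (n : ℕ) :
    p (n + 2) - 2 * (n + 2) * p (n + 1) + (n + 1) ^ 2 * p n = -((n : ℚ) / (n + 2)) := by
  have h := sum_range_pTerm_telescope n 0
  simp only [Finset.sum_add_distrib, Finset.sum_sub_distrib, ← Finset.mul_sum, cert, certDeriv,
    add_zero, Nat.cast_zero, qTerm_self] at h
  have h0 : H 0 = 0 := by simp [H]
  have h1 : H 1 = 1 := by simp [H]
  have h2 : H 2 = 3 / 2 := by norm_num [H, Finset.sum_range_succ]
  have t0 (m : ℕ) : pTerm m m = qTerm m m * (2 * H 0 - H m) := pTerm_add m 0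
  have t1 (m : ℕ) : pTerm (m + 1) m = qTerm (m + 1) m * (2 * H 1 - H m) := pTerm_add m 1
  have t2 (m : ℕ) : pTerm (m + 2) m = qTerm (m + 2) m * (2 * H 2 - H m) := pTerm_add m 2
  rw [p_eq_sum, p_eq_sum, p_eq_sum]
  simp only [Finset.sum_range_succ _ n, Finset.sum_range_succ _ (n + 1),
    Finset.sum_range_succ _ (n + 2), t0, t1, t2, qTerm_self, qTerm_succ_self,
    qTerm_add_two_self, Nat.factorial_succ, H_succ n, H_succ (n + 1), h0, h1, h2] at h ⊢
  push_cast at h ⊢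
  linear_combination (norm := skip) h
  field_simp
  ring

theorem dd_recurrence (n : ℕ) :
    dd (n + 2) = (n + 1) ^ 2 * dd (n + 1) + (n : ℚ) / (n + 2) * q (n + 1) := by
  simp only [dd]
  linear_combination p (n + 1) * q_recurrence n - q (n + 1) * p_recurrence n

theorem Delta_succ_succ (n : ℕ) :
    Δ (n + 2) = (n + 2) * (n + 1) * Δ (n + 1) + n * q (n + 1) := by
  simp only [Δ, dd_recurrence]
  push_cast
  field_simp

theorem Delta_recurrence :
    Δ 1 = -1 ∧ Δ 2 = -2 ∧ Δ 3 = -5 ∧ Δ 4 = 8 ∧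
      ∀ n : ℕ, 3 ≤ n →
        ((n : ℚ) - 1) * ((n : ℚ) - 2) * Δ (n + 2)
          = ((n : ℚ) - 2) * ((n : ℚ) + 1) * ((n : ℚ)^2 + 3 * n - 2) * Δ (n + 1)
            - (n : ℚ)^2 * (2 * (n : ℚ)^3 + (n : ℚ)^2 - 7 * n - 4) * Δ n
            + ((n : ℚ) - 1)^2 * (n : ℚ)^4 * Δ (n - 1) := by
  have q0 : q 0 = 1 := by simp [q]
  have q1 : q 1 = 2 := by norm_num [q, Finset.sum_range_succ]
  have q2 : q 2 = 7 := by linear_combination q_recurrence 0 + 4 * q1 - q0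
  have q3 : q 3 = 34 := by
    have h := q_recurrence 1
    norm_num [q1, q2] at h
    linarith
  have d1 : Δ 1 = -1 := by
    norm_num [Δ, dd, p, q, H, Finset.sum_range_succ]
  have d2 : Δ 2 = -2 := by simpa [d1] using Delta_succ_succ 0
  have d3 : Δ 3 = -5 := by rw [Delta_succ_succ 1, d2, q2]; norm_num
  have d4 : Δ 4 = 8 := by rw [Delta_succ_succ 2, d3, q3]; norm_num
  refine ⟨d1, d2, d3, d4, fun n hn => ?_⟩
  obtain ⟨m, rfl⟩ : ∃ m, n = m + 2 := ⟨n - 2, by omega⟩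
  have e0 := Delta_succ_succ m
  have e1 := Delta_succ_succ (m + 1)
  have e2 := Delta_succ_succ (m + 2)
  have r := q_recurrence (m + 1)
  simp only [add_assoc, Nat.reduceAdd] at e0 e1 e2 r ⊢
  rw [show m + 2 - 1 = m + 1 by omega]
  push_cast at e0 e1 e2 r ⊢
  rw [e2, e1, e0]
  linear_combination ((m : ℚ) + 1) * m * (m + 2) * r
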